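/- arXiv:1707.02044 — 5 statements merged into one kernel-verified Lean document; each statement's English description precedes it below -/
import Mathlib

section
/- (Finsler's Lemma.) Let n, p, q ∈ ℕ with q < n, let Π ∈ ℝ^{n×n} be symmetric, and let P ∈ ℝ^{p×n} have rank q. Let P⊥ ∈ ℝ^{n×(n−q)} be any matrix whose columns form a basis of the null space of P. Then the following three statements are equivalent: (i) xᵀ Π x < 0 for every nonzero x ∈ ℝ^n satisfying P x = 0; (ii) there exists Y ∈ ℝ^{n×p} such that Π + Y P + (Y P)ᵀ is negative definite; (iii) P⊥ᵀ Π P⊥ is negative definite. -/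
open Matrix

lemma finsler_aux (n p : ℕ) (Pm : Matrix (Fin n) (Fin n) ℝ) (P : Matrix (Fin p) (Fin n) ℝ)
    (h : ∀ x : Fin n → ℝ, x ≠ 0 → P *ᵥ x = 0 → x ⬝ᵥ (Pm *ᵥ x) < 0) :
    ∃ N : ℕ, ∀ x : Fin n → ℝ, x ≠ 0 →
      x ⬝ᵥ (Pm *ᵥ x) < N * ((P *ᵥ x) ⬝ᵥ (P *ᵥ x)) := by
  have g0 : ∀ x : Fin n → ℝ, 0 ≤ (P *ᵥ x) ⬝ᵥ (P *ᵥ x) := fun x =>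
    Finset.sum_nonneg fun i _ => mul_self_nonneg _
  obtain ⟨N, hN⟩ := (isCompact_sphere (0 : Fin n → ℝ) 1).elim_directed_cover
    (fun N : ℕ => {x : Fin n → ℝ | x ⬝ᵥ (Pm *ᵥ x) < N * ((P *ᵥ x) ⬝ᵥ (P *ᵥ x))})
    (fun N => isOpen_lt (by fun_prop) (by fun_prop))
    (by
      intro x hx
      have hx0 : x ≠ 0 := by
        rintro rfl
        simp at hx
      rw [Set.mem_iUnion]
      by_cases hP : P *ᵥ x = 0
      · exact ⟨0, by simpa using h x hx0 hP⟩
      · have hg : 0 < (P *ᵥ x) ⬝ᵥ (P *ᵥ x) :=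
          lt_of_le_of_ne (g0 x) (fun e => hP (dotProduct_self_eq_zero.1 e.symm))
        obtain ⟨N, hN⟩ := exists_nat_gt (x ⬝ᵥ (Pm *ᵥ x) / ((P *ᵥ x) ⬝ᵥ (P *ᵥ x)))
        exact ⟨N, (div_lt_iff₀ hg).1 hN⟩)
    (directed_of_isDirected_le (by
      intro a b hab x hx
      have : (a : ℝ) ≤ b := by exact_mod_cast hab
      exact lt_of_lt_of_le hx (mul_le_mul_of_nonneg_right this (g0 x))))
  refine ⟨N, fun x hx => ?_⟩
  have hn : 0 < ‖x‖ := norm_pos_iff.2 hx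
  have := hN (show ‖x‖⁻¹ • x ∈ Metric.sphere (0 : Fin n → ℝ) 1 by
    simp [norm_smul, hn.ne'])
  simp only [Set.mem_setOf_eq, mulVec_smul, smul_dotProduct, dotProduct_smul, smul_eq_mul] at this
  have hi : 0 < ‖x‖⁻¹ := inv_pos.2 hn
  have h2 : 0 < ‖x‖⁻¹ * ‖x‖⁻¹ := mul_pos hi hi
  refine lt_of_mul_lt_mul_left (a := ‖x‖⁻¹ * ‖x‖⁻¹) ?_ h2.le
  linarith

/-- **Finsler's Lemma.** Let `Pm` be a symmetric `n × n` real matrix and `P` a `p × n`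
real matrix of rank `q < n`, and let `Pperp` be an `n × (n - q)` matrix whose columns
form a basis of the null space of `P` (i.e. `x ↦ Pperp *ᵥ x` is injective with range
equal to the kernel of `x ↦ P *ᵥ x`).  Then the following are equivalent:
(i)  `xᵀ Pm x < 0` for every nonzero `x` with `P x = 0`;
(ii) there is `Y : n × p` with `Pm + Y P + (Y P)ᵀ` negative definite;
(iii) `Pperpᵀ Pm Pperp` is negative definite. -/
theorem finsler_lemma (n p q : ℕ) (hq : q < n)
    (Pm : Matrix (Fin n) (Fin n) ℝ) (hPm : Pm.IsSymm)
    (P : Matrix (Fin p) (Fin n) ℝ) (hrank : P.rank = q)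
    (Pperp : Matrix (Fin n) (Fin (n - q)) ℝ)
    (hinj : Function.Injective Pperp.mulVecLin)
    (hrange : LinearMap.range Pperp.mulVecLin = LinearMap.ker P.mulVecLin) :
    ((∀ x : Fin n → ℝ, x ≠ 0 → P *ᵥ x = 0 → x ⬝ᵥ (Pm *ᵥ x) < 0) ↔
      (∃ Y : Matrix (Fin n) (Fin p) ℝ, ∀ x : Fin n → ℝ, x ≠ 0 →
        x ⬝ᵥ ((Pm + Y * P + (Y * P)ᵀ) *ᵥ x) < 0)) ∧
    ((∃ Y : Matrix (Fin n) (Fin p) ℝ, ∀ x : Fin n → ℝ, x ≠ 0 →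
        x ⬝ᵥ ((Pm + Y * P + (Y * P)ᵀ) *ᵥ x) < 0) ↔
      (∀ z : Fin (n - q) → ℝ, z ≠ 0 → z ⬝ᵥ ((Pperpᵀ * Pm * Pperp) *ᵥ z) < 0)) := by
  have quad : ∀ (Y : Matrix (Fin n) (Fin p) ℝ) (x : Fin n → ℝ),
      x ⬝ᵥ ((Pm + Y * P + (Y * P)ᵀ) *ᵥ x) = x ⬝ᵥ (Pm *ᵥ x) + 2 * (x ⬝ᵥ (Y *ᵥ (P *ᵥ x))) := by
    intro Y x
    have : x ⬝ᵥ ((Y * P)ᵀ *ᵥ x) = x ⬝ᵥ (Y *ᵥ (P *ᵥ x)) := by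
      rw [mulVec_transpose, dotProduct_comm, ← dotProduct_mulVec, mulVec_mulVec]
    rw [add_mulVec, add_mulVec, dotProduct_add, dotProduct_add, this, ← mulVec_mulVec]
    ring
  have h12 : (∀ x : Fin n → ℝ, x ≠ 0 → P *ᵥ x = 0 → x ⬝ᵥ (Pm *ᵥ x) < 0) ↔
      (∃ Y : Matrix (Fin n) (Fin p) ℝ, ∀ x : Fin n → ℝ, x ≠ 0 →
        x ⬝ᵥ ((Pm + Y * P + (Y * P)ᵀ) *ᵥ x) < 0) := by
    constructor
    · intro h
      obtain ⟨N, hN⟩ := finsler_aux n p Pm P h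
      refine ⟨(-(N : ℝ) / 2) • Pᵀ, fun x hx => ?_⟩
      have e : x ⬝ᵥ (Pᵀ *ᵥ (P *ᵥ x)) = (P *ᵥ x) ⬝ᵥ (P *ᵥ x) := by
        rw [dotProduct_mulVec, vecMul_transpose]
      rw [quad, smul_mulVec, dotProduct_smul, e, smul_eq_mul]
      have := hN x hx
      linarith
    · rintro ⟨Y, hY⟩ x hx hP
      have := hY x hx
      rw [quad, hP] at this
      simpa using this
  refine ⟨h12, h12.symm.trans ?_⟩
  have e : ∀ z, z ⬝ᵥ ((Pperpᵀ * Pm * Pperp) *ᵥ z) = (Pperp *ᵥ z) ⬝ᵥ (Pm *ᵥ (Pperp *ᵥ z)) := by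
    intro z
    rw [← mulVec_mulVec, ← mulVec_mulVec, dotProduct_mulVec, vecMul_transpose]
  constructor
  · intro h z hz
    rw [e]
    refine h _ (fun h0 => hz (hinj (by simpa using h0))) ?_
    have : Pperp.mulVecLin z ∈ LinearMap.ker P.mulVecLin := hrange ▸ LinearMap.mem_range_self _ z
    simpa using this
  · intro h x hx hP
    have : x ∈ LinearMap.range Pperp.mulVecLin := by
      rw [hrange]
      simpa using hP
    obtain ⟨z, rfl⟩ := this
    have hz : z ≠ 0 := by
      rintro rfl
      simp at hx
    simpa only [e, mulVecLin_apply] using h z hz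
end

section
/- (Projection Lemma.) Let n, p, q ∈ ℕ, let Π ∈ ℝ^{n×n} be symmetric, and let P ∈ ℝ^{q×n} and Q ∈ ℝ^{p×n}. Let P⊥ and Q⊥ be matrices whose columns form bases of the null spaces of P and Q respectively. Then there exists Υ ∈ ℝ^{p×q} such that Π + Pᵀ Υᵀ Q + Qᵀ Υ P is negative definite if and only if both P⊥ᵀ Π P⊥ and Q⊥ᵀ Π Q⊥ are negative definite. -/
open Matrix

/-- Generalized inverse of a linear map. -/
lemma exists_ginv {V W : Type*} [AddCommGroup V] [Module ℝ V] [AddCommGroup W] [Module ℝ W]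
    (f : V →ₗ[ℝ] W) : ∃ g : W →ₗ[ℝ] V, ∀ x, f (g (f x)) = f x := by
  obtain ⟨h, hh⟩ := LinearMap.exists_rightInverse_of_surjective f.rangeRestrict
    f.range_rangeRestrict
  obtain ⟨g, hg⟩ := LinearMap.exists_extend h
  refine ⟨g, fun x => ?_⟩
  have h1 : g (f x) = h (f.rangeRestrict x) := by
    rw [← hg]; rfl
  have h2 := LinearMap.congr_fun hh (f.rangeRestrict x)
  rw [h1]
  exact congrArg Subtype.val h2

/-- Orthogonal projection onto a subspace on which the form is negative definite. -/
lemma exists_oproj {V : Type*} [AddCommGroup V] [Module ℝ V] [FiniteDimensional ℝ V]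
    (B : V →ₗ[ℝ] V →ₗ[ℝ] ℝ) (N : Submodule ℝ V) (hN : ∀ x ∈ N, x ≠ 0 → B x x < 0) :
    ∃ e : V →ₗ[ℝ] V, (∀ x, e x ∈ N) ∧ (∀ x ∈ N, e x = x) ∧
      ∀ x, ∀ y ∈ N, B (x - e x) y = 0 := by
  let ψ : V →ₗ[ℝ] Module.Dual ℝ N := B.compl₂ N.subtype
  let φ : N →ₗ[ℝ] Module.Dual ℝ N := ψ ∘ₗ N.subtype
  have hinj : Function.Injective φ := by
    rw [← LinearMap.ker_eq_bot, LinearMap.ker_eq_bot']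
    intro m hm
    by_contra hne
    have h1 := hN m m.2 (by simpa using hne)
    have h2 : φ m m = B m m := rfl
    rw [hm] at h2
    simp at h2
    linarith
  let E := LinearEquiv.ofInjectiveOfFinrankEq φ hinj (Subspace.dual_finrank_eq).symm
  have hE : ∀ m, E m = φ m := fun m => rfl
  have key : ∀ x, ψ (E.symm (ψ x) : V) = ψ x := fun x => by
    have := E.apply_symm_apply (ψ x)
    rwa [hE] at this
  refine ⟨N.subtype ∘ₗ E.symm.toLinearMap ∘ₗ ψ, fun x => (E.symm (ψ x)).2, ?_, ?_⟩
  · intro x hx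
    have : E.symm (ψ x) = ⟨x, hx⟩ := by
      rw [LinearEquiv.symm_apply_eq]; rfl
    simp [this]
  · intro x y hy
    have := LinearMap.congr_fun (key x) ⟨y, hy⟩
    change B _ y = B x y at this
    simp [this]

/-- Linear decomposition `x = k x + l x + w x`. -/
lemma exists_decomp {V : Type*} [AddCommGroup V] [Module ℝ V] (K L : Submodule ℝ V) :
    ∃ k l w : V →ₗ[ℝ] V, (∀ x, k x ∈ K) ∧ (∀ x, l x ∈ L) ∧ (∀ x, k x + l x + w x = x) ∧
      (∀ x ∈ K, w x = 0) ∧ (∀ x ∈ L, w x = 0) := by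
  let f : (K × L) →ₗ[ℝ] V := K.subtype.coprod L.subtype
  obtain ⟨g, hg⟩ := exists_ginv f
  refine ⟨K.subtype ∘ₗ LinearMap.fst ℝ K L ∘ₗ g, L.subtype ∘ₗ LinearMap.snd ℝ K L ∘ₗ g,
    LinearMap.id - f ∘ₗ g, fun x => (g x).1.2, fun x => (g x).2.2, fun x => ?_, ?_, ?_⟩
  · simp [f]
  · intro x hx
    have := hg (⟨x, hx⟩, 0)
    have h2 : f (⟨x, hx⟩, 0) = x := by simp [f]
    rw [h2] at this
    simp [this]
  · intro x hx
    have := hg (0, ⟨x, hx⟩)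
    have h2 : f (0, ⟨x, hx⟩) = x := by simp [f]
    rw [h2] at this
    simp [this]

lemma projection_core {V W Z : Type*} [AddCommGroup V] [Module ℝ V] [FiniteDimensional ℝ V]
    [AddCommGroup W] [Module ℝ W] [AddCommGroup Z] [Module ℝ Z]
    (B D : V →ₗ[ℝ] V →ₗ[ℝ] ℝ) (hB : ∀ x y, B x y = B y x) (hD : ∀ x, x ≠ 0 → 0 < D x x)
    (P : V →ₗ[ℝ] W) (Q : V →ₗ[ℝ] Z)
    (hP : ∀ x, P x = 0 → x ≠ 0 → B x x < 0) (hQ : ∀ x, Q x = 0 → x ≠ 0 → B x x < 0) :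
    ∃ U : Z →ₗ[ℝ] W →ₗ[ℝ] ℝ, ∀ x, x ≠ 0 → B x x + 2 * U (Q x) (P x) < 0 := by
  obtain ⟨e, heN, he, heo⟩ := exists_oproj B (LinearMap.ker P ⊓ LinearMap.ker Q)
    (fun x hx hne => hP x hx.1 hne)
  obtain ⟨k, l, w, hk, hl, hs, hwK, hwL⟩ := exists_decomp (LinearMap.ker P) (LinearMap.ker Q)
  obtain ⟨gP, hgP⟩ := exists_ginv P
  obtain ⟨gQ, hgQ⟩ := exists_ginv Q
  simp only [LinearMap.mem_ker, Submodule.mem_inf] at *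
  let r : V →ₗ[ℝ] V := LinearMap.id - e
  have hr : ∀ x, r x = x - e x := fun x => rfl
  let a := r ∘ₗ k
  let b := r ∘ₗ l
  let c := r ∘ₗ w
  have haP : ∀ x, P (a x) = 0 := fun x => by
    change P (r (k x)) = 0
    rw [hr, map_sub, hk, (heN _).1, sub_zero]
  have hbQ : ∀ x, Q (b x) = 0 := fun x => by
    change Q (r (l x)) = 0
    rw [hr, map_sub, hl, (heN _).2, sub_zero]
  have haL : ∀ x, Q x = 0 → a x = 0 := fun x hx => by
    change r (k x) = 0
    rw [hr, he _ ⟨hk x, ?_⟩, sub_self]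
    have := congrArg Q (hs x)
    simpa [hl, hwL x hx, hx] using this
  have hbK : ∀ x, P x = 0 → b x = 0 := fun x hx => by
    change r (l x) = 0
    rw [hr, he _ ⟨?_, hl x⟩, sub_self]
    have := congrArg P (hs x)
    simpa [hk, hwK x hx, hx] using this
  have hcK : ∀ x, P x = 0 → c x = 0 := fun x hx => by
    change r (w x) = 0
    rw [hwK x hx, map_zero]
  have hcL : ∀ x, Q x = 0 → c x = 0 := fun x hx => by
    change r (w x) = 0
    rw [hwL x hx, map_zero]
  have hsum : ∀ x, x = e x + (a x + b x + c x) := fun x => by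
    have : a x + b x + c x = r x := by
      change r (k x) + r (l x) + r (w x) = r x
      rw [← map_add, ← map_add, hs]
    rw [this, hr]; abel
  let F : V →ₗ[ℝ] V →ₗ[ℝ] ℝ :=
    -(B.compl₁₂ a b) - B.compl₁₂ a c - B.compl₁₂ c b
      - (1/2 : ℝ) • (B.compl₁₂ c c) - (1/2 : ℝ) • (D.compl₁₂ c c)
  have hF : ∀ x y, F x y = -B (a x) (b y) - B (a x) (c y) - B (c x) (b y)
      - 1/2 * B (c x) (c y) - 1/2 * D (c x) (c y) := fun x y => by
    simp [F]
  have hFQ : ∀ x y, F (gQ (Q x)) y = F x y := fun x y => by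
    have h0 : Q (gQ (Q x) - x) = 0 := by rw [map_sub, hgQ, sub_self]
    have : F (gQ (Q x) - x) y = 0 := by
      rw [hF, haL _ h0, hcL _ h0]; simp
    rw [map_sub, LinearMap.sub_apply] at this
    linarith
  have hFP : ∀ x y, F x (gP (P y)) = F x y := fun x y => by
    have h0 : P (gP (P y) - y) = 0 := by rw [map_sub, hgP, sub_self]
    have : F x (gP (P y) - y) = 0 := by
      rw [hF, hbK _ h0, hcK _ h0]; simp
    rw [map_sub] at this
    linarith
  refine ⟨F.compl₁₂ gQ gP, fun x hx => ?_⟩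
  rw [LinearMap.compl₁₂_apply, hFQ, hFP, hF]
  have horth : B (a x + b x + c x) (e x) = 0 := by
    have h1 := heo x (e x) (heN x)
    have h2 : a x + b x + c x = x - e x := by
      rw [eq_sub_iff_add_eq, add_comm]; exact (hsum x).symm
    rw [h2]; exact h1
  have hBx : B x x = B (e x) (e x) + B (a x) (a x) + B (b x) (b x) + B (c x) (c x)
      + 2 * B (a x) (b x) + 2 * B (a x) (c x) + 2 * B (c x) (b x) := by
    have h1 : B x x = B (e x + (a x + b x + c x)) (e x + (a x + b x + c x)) := by
      rw [← hsum x]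
    have h2 := hB (e x) (a x + b x + c x)
    rw [h1]
    rw [horth] at h2
    rw [map_add B (e x), LinearMap.add_apply, map_add (B (e x)), h2, map_add _ (e x), horth]
    simp only [map_add, LinearMap.add_apply]
    rw [hB (b x) (a x), hB (c x) (a x), hB (b x) (c x)]
    ring
  have n1 : e x ≠ 0 → B (e x) (e x) < 0 := hP _ (heN x).1
  have n2 : a x ≠ 0 → B (a x) (a x) < 0 := hP _ (haP x)
  have n3 : b x ≠ 0 → B (b x) (b x) < 0 := hQ _ (hbQ x)
  have n4 := hD (c x)
  have m1 : B (e x) (e x) ≤ 0 := by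
    by_cases h : e x = 0
    · simp [h]
    · exact (n1 h).le
  have m2 : B (a x) (a x) ≤ 0 := by
    by_cases h : a x = 0
    · simp [h]
    · exact (n2 h).le
  have m3 : B (b x) (b x) ≤ 0 := by
    by_cases h : b x = 0
    · simp [h]
    · exact (n3 h).le
  have m4 : 0 ≤ D (c x) (c x) := by
    by_cases h : c x = 0
    · simp [h]
    · exact (n4 h).le
  by_cases h1 : e x = 0
  · by_cases h2 : a x = 0
    · by_cases h3 : b x = 0
      · by_cases h4 : c x = 0
        · exact absurd (by rw [hsum x, h1, h2, h3, h4]; simp) hx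
        · linarith [n4 h4]
      · linarith [n3 h3]
    · linarith [n2 h2]
  · linarith [n1 h1]

lemma compress_eq {n s : ℕ} (M : Matrix (Fin n) (Fin n) ℝ) (T : Matrix (Fin n) (Fin s) ℝ)
    (z : Fin s → ℝ) : z ⬝ᵥ ((Tᵀ * M * T) *ᵥ z) = (T *ᵥ z) ⬝ᵥ (M *ᵥ (T *ᵥ z)) := by
  rw [← mulVec_mulVec, ← mulVec_mulVec, dotProduct_mulVec, vecMul_transpose]

lemma quad_eq {n p q : ℕ} (Pm : Matrix (Fin n) (Fin n) ℝ)
    (P : Matrix (Fin q) (Fin n) ℝ) (Q : Matrix (Fin p) (Fin n) ℝ)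
    (Y : Matrix (Fin p) (Fin q) ℝ) (x : Fin n → ℝ) :
    x ⬝ᵥ ((Pm + Pᵀ * Yᵀ * Q + Qᵀ * Y * P) *ᵥ x)
      = x ⬝ᵥ (Pm *ᵥ x) + 2 * ((Q *ᵥ x) ⬝ᵥ (Y *ᵥ (P *ᵥ x))) := by
  have h1 : x ⬝ᵥ ((Qᵀ * Y * P) *ᵥ x) = (Q *ᵥ x) ⬝ᵥ (Y *ᵥ (P *ᵥ x)) := by
    rw [← mulVec_mulVec, ← mulVec_mulVec, dotProduct_mulVec, vecMul_transpose]
  have h2 : x ⬝ᵥ ((Pᵀ * Yᵀ * Q) *ᵥ x) = (Q *ᵥ x) ⬝ᵥ (Y *ᵥ (P *ᵥ x)) := by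
    rw [← mulVec_mulVec, ← mulVec_mulVec, dotProduct_mulVec, vecMul_transpose,
      dotProduct_mulVec, vecMul_transpose, dotProduct_comm]
  rw [add_mulVec, add_mulVec, dotProduct_add, dotProduct_add, h1, h2]
  ring

lemma negdef_iff {n s m : ℕ} (M : Matrix (Fin n) (Fin n) ℝ) (T : Matrix (Fin n) (Fin s) ℝ)
    (P : Matrix (Fin m) (Fin n) ℝ) (hinj : Function.Injective T.mulVecLin)
    (hr : LinearMap.range T.mulVecLin = LinearMap.ker P.mulVecLin) :
    (∀ z : Fin s → ℝ, z ≠ 0 → z ⬝ᵥ ((Tᵀ * M * T) *ᵥ z) < 0) ↔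
    ∀ x : Fin n → ℝ, P *ᵥ x = 0 → x ≠ 0 → x ⬝ᵥ (M *ᵥ x) < 0 := by
  constructor
  · intro h x hx hne
    have : x ∈ LinearMap.range T.mulVecLin := by rw [hr]; exact hx
    obtain ⟨z, rfl⟩ := this
    have := h z (by rintro rfl; simp at hne)
    rwa [compress_eq] at this
  · intro h z hz
    rw [compress_eq]
    refine h _ ?_ ?_
    · have : T.mulVecLin z ∈ LinearMap.ker P.mulVecLin := by rw [← hr]; exact ⟨z, rfl⟩
      exact this
    · intro h0
      exact hz (hinj (by simpa using h0))

/-- **Projection Lemma.** Let `Pm` be a symmetric `n × n` real matrix,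
`P : q × n` and `Q : p × n`, and let `Pperp`, `Qperp` be matrices whose columns form
bases of the null spaces of `P` and `Q` respectively.  Then there exists
`Υ : p × q` with `Pm + Pᵀ Υᵀ Q + Qᵀ Υ P` negative definite iff both
`Pperpᵀ Pm Pperp` and `Qperpᵀ Pm Qperp` are negative definite. -/
theorem projection_lemma (n p q sP sQ : ℕ)
    (Pm : Matrix (Fin n) (Fin n) ℝ) (hPm : Pm.IsSymm)
    (P : Matrix (Fin q) (Fin n) ℝ) (Q : Matrix (Fin p) (Fin n) ℝ)
    (Pperp : Matrix (Fin n) (Fin sP) ℝ) (Qperp : Matrix (Fin n) (Fin sQ) ℝ)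
    (hPinj : Function.Injective Pperp.mulVecLin)
    (hPrange : LinearMap.range Pperp.mulVecLin = LinearMap.ker P.mulVecLin)
    (hQinj : Function.Injective Qperp.mulVecLin)
    (hQrange : LinearMap.range Qperp.mulVecLin = LinearMap.ker Q.mulVecLin) :
    (∃ Υ : Matrix (Fin p) (Fin q) ℝ, ∀ x : Fin n → ℝ, x ≠ 0 →
        x ⬝ᵥ ((Pm + Pᵀ * Υᵀ * Q + Qᵀ * Υ * P) *ᵥ x) < 0) ↔
    ((∀ z : Fin sP → ℝ, z ≠ 0 → z ⬝ᵥ ((Pperpᵀ * Pm * Pperp) *ᵥ z) < 0) ∧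
     (∀ z : Fin sQ → ℝ, z ≠ 0 → z ⬝ᵥ ((Qperpᵀ * Pm * Qperp) *ᵥ z) < 0)) := by
  rw [negdef_iff Pm Pperp P hPinj hPrange, negdef_iff Pm Qperp Q hQinj hQrange]
  simp only [quad_eq]
  constructor
  · rintro ⟨Y, hY⟩
    refine ⟨fun x hx hne => ?_, fun x hx hne => ?_⟩
    · simpa [hx] using hY x hne
    · simpa [hx] using hY x hne
  · rintro ⟨h1, h2⟩
    have happ : ∀ {a b : ℕ} (M : Matrix (Fin a) (Fin b) ℝ) x y,
        Matrix.toLinearMap₂' ℝ M x y = x ⬝ᵥ (M *ᵥ y) := fun M x y =>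
      Matrix.toLinearMap₂'_apply' M x y
    obtain ⟨U, hU⟩ := projection_core (Matrix.toLinearMap₂' ℝ Pm)
      (Matrix.toLinearMap₂' ℝ (1 : Matrix (Fin n) (Fin n) ℝ))
      (fun x y => by
        rw [happ, happ, dotProduct_mulVec, ← mulVec_transpose, hPm.eq, dotProduct_comm])
      (fun x hx => by
        rw [happ, one_mulVec]
        exact lt_of_le_of_ne (Finset.sum_nonneg fun i _ => mul_self_nonneg _)
          (fun h => hx (dotProduct_self_eq_zero.1 h.symm)))
      P.mulVecLin Q.mulVecLin
      (fun x hx hne => by rw [happ]; exact h1 x hx hne)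
      (fun x hx hne => by rw [happ]; exact h2 x hx hne)
    refine ⟨LinearMap.toMatrix₂' ℝ U, fun x hx => ?_⟩
    have := hU x hx
    rw [← happ, ← happ, Matrix.toLinearMap₂'_toMatrix']
    exact this
end

section
/- Let r > 0, d, ν ∈ ℕ, M ∈ ℝ^{d×d}, let f : ℝ → ℝ^d be continuously differentiable with f′(τ) = M f(τ) for all τ, and let y : ℝ → ℝ^ν be continuous. Define g(t) = ∫_{−r}^{0} (f(τ) ⊗ I_ν) y(t+τ) dτ ∈ ℝ^{dν}. Then g is differentiable, and for every t, g′(t) = (f(0) ⊗ I_ν) y(t) − (f(−r) ⊗ I_ν) y(t−r) − (M ⊗ I_ν) g(t). -/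
open Matrix MeasureTheory
open scoped Kronecker

/-- The Kronecker product `v ⊗ I_ν` of a column vector `v ∈ ℝ^d` with the `ν × ν`
identity matrix, viewed as a `(d·ν) × ν` real matrix. -/
def vecKronId (d ν : ℕ) (v : Fin d → ℝ) : Matrix (Fin d × Fin ν) (Fin ν) ℝ :=
  fun p j => v p.1 * (1 : Matrix (Fin ν) (Fin ν) ℝ) p.2 j

theorem scalar_delay_deriv (r : ℝ) (p p' u : ℝ → ℝ)
    (hp : ∀ x, HasDerivAt p (p' x) x) (hp' : Continuous p') (hu : Continuous u) (t : ℝ) :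
    HasDerivAt (fun t => ∫ x in (-r)..0, p x * u (t + x))
      (p 0 * u t - p (-r) * u (t - r) - ∫ x in (-r)..0, p' x * u (t + x)) t := by
  have hU : ∀ x, HasDerivAt (fun s => ∫ z in (0:ℝ)..s, u z) (u x) x := fun x =>
    (intervalIntegral.integral_hasStrictDerivAt_right (hu.intervalIntegrable _ _)
      (hu.stronglyMeasurableAtFilter _ _) hu.continuousAt).hasDerivAt
  generalize (fun s => ∫ z in (0:ℝ)..s, u z) = U at hU
  have hUc : Continuous U := continuous_iff_continuousAt.2 fun x => (hU x).continuousAt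
  have key : (fun t => ∫ x in (-r)..0, p x * u (t + x)) =
      fun t => p 0 * U t - p (-r) * U (t - r) - ∫ x in (-r)..0, p' x * U (t + x) := by
    funext t
    have h := intervalIntegral.integral_mul_deriv_eq_deriv_mul (a := -r) (b := 0)
      (u := p) (u' := p') (v := fun x => U (t + x)) (v' := fun x => u (t + x))
      (fun x _ => hp x) (fun x _ => (hU (t + x)).comp_const_add t x)
      (hp'.intervalIntegrable _ _)
      ((hu.comp (continuous_const.add continuous_id)).intervalIntegrable _ _)
    rw [h]
    simp [sub_eq_add_neg]
  rw [key]
  have h3 : HasDerivAt (fun t => ∫ x in (-r)..0, p' x * U (t + x))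
      (∫ x in (-r)..0, p' x * u (t + x)) t := by
    have hc : Continuous fun q : ℝ × ℝ => p' q.2 * u (q.1 + q.2) := by fun_prop
    obtain ⟨C, hC⟩ := ((isCompact_closedBall t 1).prod
      (isCompact_uIcc (a := -r) (b := 0))).exists_bound_of_continuousOn hc.continuousOn
    refine (intervalIntegral.hasDerivAt_integral_of_dominated_loc_of_deriv_le
      (F := fun t x => p' x * U (t + x)) (F' := fun t x => p' x * u (t + x))
      (bound := fun _ => C)
      (Metric.closedBall_mem_nhds t one_pos) ?_ ?_ ?_ ?_ ?_ ?_).2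
    · refine Filter.Eventually.of_forall fun s => ?_
      exact Continuous.aestronglyMeasurable (by fun_prop)
    · exact Continuous.intervalIntegrable (by fun_prop) _ _
    · exact Continuous.aestronglyMeasurable (by fun_prop)
    · exact Filter.Eventually.of_forall fun x hx s hs =>
        hC (s, x) ⟨hs, Set.uIoc_subset_uIcc hx⟩
    · exact continuous_const.intervalIntegrable _ _
    · exact Filter.Eventually.of_forall fun x hx s hs =>
        ((hU (s + x)).comp_add_const s x).const_mul _
  have h2 : HasDerivAt (fun t => U (t - r)) (u (t - r)) t := (hU (t - r)).comp_sub_const t r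
  exact (((hU t).const_mul _).sub (h2.const_mul _)).sub h3

theorem vecKronId_mulVec (d ν : ℕ) (v : Fin d → ℝ) (w : Fin ν → ℝ) (i : Fin d × Fin ν) :
    (vecKronId d ν v *ᵥ w) i = v i.1 * w i.2 := by
  simp [vecKronId, Matrix.mulVec, dotProduct, Matrix.one_apply]

theorem kron_one_mulVec (d ν : ℕ) (M : Matrix (Fin d) (Fin d) ℝ) (w : Fin d × Fin ν → ℝ)
    (i : Fin d × Fin ν) :
    ((M ⊗ₖ (1 : Matrix (Fin ν) (Fin ν) ℝ)) *ᵥ w) i = ∑ k, M i.1 k * w (k, i.2) := by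
  simp [Matrix.mulVec, dotProduct, Matrix.one_apply, Fintype.sum_prod_type]

/-- If `f : ℝ → ℝ^d` is (continuously) differentiable with `f' = M f` and
`y : ℝ → ℝ^ν` is continuous, then `g(t) = ∫_{-r}^0 (f(τ) ⊗ I_ν) y(t+τ) dτ` is
differentiable with
`g'(t) = (f(0) ⊗ I_ν) y(t) - (f(-r) ⊗ I_ν) y(t-r) - (M ⊗ I_ν) g(t)`. -/
theorem deriv_of_distributed_delay_term (r : ℝ) (hr : 0 < r) (d ν : ℕ)
    (M : Matrix (Fin d) (Fin d) ℝ) (f : ℝ → Fin d → ℝ) (y : ℝ → Fin ν → ℝ)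
    (hf : ∀ τ : ℝ, HasDerivAt f (M *ᵥ f τ) τ) (hy : Continuous y)
    (g : ℝ → Fin d × Fin ν → ℝ)
    (hg : ∀ t : ℝ, g t = ∫ τ in (-r)..0, (vecKronId d ν (f τ)) *ᵥ y (t + τ)) :
    ∀ t : ℝ, HasDerivAt g
      ((vecKronId d ν (f 0)) *ᵥ y t - (vecKronId d ν (f (-r))) *ᵥ y (t - r)
        - (M ⊗ₖ (1 : Matrix (Fin ν) (Fin ν) ℝ)) *ᵥ g t) t := by
  have hfc : Continuous f := continuous_iff_continuousAt.2 fun x => (hf x).continuousAt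
  have hgi : ∀ t i, g t i = ∫ τ in (-r)..0, f τ i.1 * y (t + τ) i.2 := by
    intro t i
    have hcont : Continuous fun τ => (vecKronId d ν (f τ)) *ᵥ y (t + τ) := by
      refine continuous_pi fun i => ?_
      simp only [vecKronId_mulVec]
      fun_prop
    have h := (ContinuousLinearMap.proj (R := ℝ) (φ := fun _ : Fin d × Fin ν => ℝ)
      i).intervalIntegral_comp_comm (hcont.intervalIntegrable (μ := volume) (-r) 0)
    simp only [ContinuousLinearMap.proj_apply, vecKronId_mulVec] at h
    rw [hg, h]
  intro t
  rw [hasDerivAt_pi]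
  intro i
  have h := scalar_delay_deriv r (fun τ => f τ i.1) (fun τ => (M *ᵥ f τ) i.1) (fun s => y s i.2)
    (fun x => (hasDerivAt_pi.1 (hf x)) i.1) (by fun_prop) (by fun_prop) t
  simp only [Pi.sub_apply, vecKronId_mulVec, kron_one_mulVec, hgi]
  refine h.congr_deriv ?_
  congr 1
  simp only [Matrix.mulVec, dotProduct, Finset.sum_mul]
  rw [intervalIntegral.integral_finsetSum]
  · simp only [mul_assoc, intervalIntegral.integral_const_mul]
  · intro k _
    exact Continuous.intervalIntegrable (by fun_prop) _ _
end

section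
/- (Bessel-type integral inequality.) Let r > 0, d, ν ∈ ℕ, let f : [−r, 0] → ℝ^d be continuous and suppose the Gram matrix G = ∫_{−r}^{0} f(τ) f(τ)ᵀ dτ ∈ ℝ^{d×d} is positive definite; set 𝖥 = G^{−1}. Let S ∈ ℝ^{ν×ν} be symmetric positive definite and let y : [−r, 0] → ℝ^ν be continuous. Then ∫_{−r}^{0} y(τ)ᵀ S y(τ) dτ ≥ wᵀ (𝖥 ⊗ S) w, where w = ∫_{−r}^{0} (f(τ) ⊗ I_ν) y(τ) dτ ∈ ℝ^{dν}. -/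
open Matrix MeasureTheory
open scoped Kronecker

/-- **Bessel-type integral inequality.**  If `f : [-r,0] → ℝ^d` is continuous with
positive definite Gram matrix `G = ∫_{-r}^0 f fᵀ`, `S` is symmetric positive definite
and `y : [-r,0] → ℝ^ν` is continuous, then
`∫_{-r}^0 yᵀ S y ≥ wᵀ (G⁻¹ ⊗ S) w` where `w = ∫_{-r}^0 (f(τ) ⊗ I_ν) y(τ) dτ`. -/
theorem bessel_integral_inequality (r : ℝ) (hr : 0 < r) (d ν : ℕ)
    (f : ℝ → Fin d → ℝ) (hf : ContinuousOn f (Set.Icc (-r) 0))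
    (G : Matrix (Fin d) (Fin d) ℝ)
    (hG : ∀ i j, G i j = ∫ τ in (-r)..0, f τ i * f τ j)
    (hGpd : G.PosDef)
    (S : Matrix (Fin ν) (Fin ν) ℝ) (hS : S.PosDef)
    (y : ℝ → Fin ν → ℝ) (hy : ContinuousOn y (Set.Icc (-r) 0))
    (w : Fin d × Fin ν → ℝ)
    (hw : w = ∫ τ in (-r)..0, (vecKronId d ν (f τ)) *ᵥ y τ) :
    (∫ τ in (-r)..0, y τ ⬝ᵥ (S *ᵥ y τ)) ≥ w ⬝ᵥ ((G⁻¹ ⊗ₖ S) *ᵥ w) := by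
  have hle : -r ≤ 0 := by linarith
  have hfi : ∀ i, ContinuousOn (fun τ => f τ i) (Set.Icc (-r) 0) := fun i =>
    (continuous_apply i).comp_continuousOn hf
  have hyi : ∀ i, ContinuousOn (fun τ => y τ i) (Set.Icc (-r) 0) := fun i =>
    (continuous_apply i).comp_continuousOn hy
  have hint : ∀ g : ℝ → ℝ, ContinuousOn g (Set.Icc (-r) 0) →
      IntervalIntegrable g volume (-r) 0 := fun g hg =>
    hg.intervalIntegrable_of_Icc hle
  have hwc : ∀ i b, w (i, b) = ∫ τ in (-r)..0, f τ i * y τ b := by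
    intro i b
    have h1 : ∀ τ, vecKronId d ν (f τ) *ᵥ y τ = fun p => f τ p.1 * y τ p.2 := by
      intro τ
      ext p
      simp [vecKronId, mulVec, dotProduct, Matrix.one_apply]
    have h2 : ContinuousOn (fun τ => fun p : Fin d × Fin ν => f τ p.1 * y τ p.2)
        (Set.Icc (-r) 0) :=
      continuousOn_pi.2 fun p => (hfi p.1).mul (hyi p.2)
    have h3 := (ContinuousLinearMap.proj (R := ℝ) (φ := fun _ : Fin d × Fin ν => ℝ)
      (i, b)).intervalIntegral_comp_comm (h2.intervalIntegrable_of_Icc (μ := volume) hle)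
    simp only [h1] at hw
    rw [hw]
    exact h3.symm
  obtain ⟨c, hc⟩ : ∃ c : Fin d → Fin ν → ℝ, c = fun j b => ∑ i, G⁻¹ j i * w (i, b) := ⟨_, rfl⟩
  have hGu : IsUnit G.det := (Matrix.isUnit_iff_isUnit_det _).1 hGpd.isUnit
  have hGc : ∀ i b, w (i, b) = ∑ k, G i k * c k b := by
    intro i b
    have h : G *ᵥ (G⁻¹ *ᵥ fun i => w (i, b)) = fun i => w (i, b) := by
      rw [mulVec_mulVec, Matrix.mul_nonsing_inv _ hGu, one_mulVec]
    have := congrFun h i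
    rw [hc]
    exact this.symm
  have hGs : ∀ i j, G i j = G j i := fun i j => by
    rw [hG, hG]; simp only [mul_comm]
  obtain ⟨z, hz⟩ : ∃ z : ℝ → Fin ν → ℝ, z = fun τ b => ∑ j, c j b * f τ j := ⟨_, rfl⟩
  have hzi : ∀ i, ContinuousOn (fun τ => z τ i) (Set.Icc (-r) 0) := fun i => by
    rw [hz]
    exact continuousOn_finsetSum _ fun j _ => continuousOn_const.mul (hfi j)
  have hzy : ∀ a b, ∫ τ in (-r)..0, z τ a * y τ b = ∑ j, c j a * w (j, b) := by
    intro a b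
    simp only [hz, Finset.sum_mul, mul_assoc]
    rw [intervalIntegral.integral_finsetSum]
    · simp only [intervalIntegral.integral_const_mul, hwc]
    · exact fun j _ => hint _ (continuousOn_const.mul ((hfi j).mul (hyi b)))
  have hzf : ∀ i b, ∫ τ in (-r)..0, f τ i * z τ b = w (i, b) := by
    intro i b
    have : ∀ τ, f τ i * z τ b = ∑ j, c j b * (f τ i * f τ j) := by
      intro τ
      simp only [hz, Finset.mul_sum]
      exact Finset.sum_congr rfl fun _ _ => by ring
    simp only [this]
    rw [intervalIntegral.integral_finsetSum]
    · simp only [intervalIntegral.integral_const_mul, ← hG, hGc i b]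
      exact Finset.sum_congr rfl fun _ _ => by ring
    · exact fun j _ => hint _ (continuousOn_const.mul ((hfi i).mul (hfi j)))
  have hzz : ∀ a b, ∫ τ in (-r)..0, z τ a * z τ b = ∑ j, c j a * w (j, b) := by
    intro a b
    have : ∀ τ, z τ a * z τ b = ∑ j, c j a * (f τ j * z τ b) := by
      intro τ
      conv_lhs => rw [hz]
      simp only [Finset.sum_mul, mul_assoc, hz]
    simp only [this]
    rw [intervalIntegral.integral_finsetSum]
    · simp only [intervalIntegral.integral_const_mul, hzf]
    · exact fun j _ => hint _ (continuousOn_const.mul ((hfi j).mul (hzi b)))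
  have hPs : ∀ a b, ∑ j, c j a * w (j, b) = ∑ j, c j b * w (j, a) := by
    intro a b
    rw [← hzz, ← hzz]; simp only [mul_comm]
  have hyy : ∀ a b, ∫ τ in (-r)..0, (y τ a - z τ a) * (y τ b - z τ b)
      = (∫ τ in (-r)..0, y τ a * y τ b) - ∑ j, c j a * w (j, b) := by
    intro a b
    have : ∀ τ, (y τ a - z τ a) * (y τ b - z τ b) =
        (y τ a * y τ b - z τ a * y τ b) - (z τ b * y τ a - z τ a * z τ b) := by
      intro τ; ring
    have i1 := hint (fun τ => y τ a * y τ b) ((hyi a).mul (hyi b))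
    have i2 := hint (fun τ => z τ a * y τ b) ((hzi a).mul (hyi b))
    have i3 := hint (fun τ => z τ b * y τ a) ((hzi b).mul (hyi a))
    have i4 := hint (fun τ => z τ a * z τ b) ((hzi a).mul (hzi b))
    simp only [this]
    rw [intervalIntegral.integral_sub (i1.sub i2) (i3.sub i4),
      intervalIntegral.integral_sub i1 i2, intervalIntegral.integral_sub i3 i4,
      hzy, hzy, hzz, hPs b a]
    ring
  have hquad : ∀ u : ℝ → Fin ν → ℝ, (∀ i, ContinuousOn (fun τ => u τ i) (Set.Icc (-r) 0)) →
      ∫ τ in (-r)..0, u τ ⬝ᵥ (S *ᵥ u τ) =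
        ∑ a, ∑ b, S a b * ∫ τ in (-r)..0, u τ a * u τ b := by
    intro u hu
    have : ∀ τ, u τ ⬝ᵥ (S *ᵥ u τ) = ∑ a, ∑ b, S a b * (u τ a * u τ b) := by
      intro τ
      simp only [dotProduct, mulVec, Finset.mul_sum]
      exact Finset.sum_congr rfl fun _ _ => Finset.sum_congr rfl fun _ _ => by ring
    have hcont : ∀ a b, ContinuousOn (fun τ => S a b * (u τ a * u τ b)) (Set.Icc (-r) 0) :=
      fun a b => continuousOn_const.mul ((hu a).mul (hu b))
    simp only [this]
    rw [intervalIntegral.integral_finsetSum]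
    · refine Finset.sum_congr rfl fun a _ => ?_
      rw [intervalIntegral.integral_finsetSum]
      · simp only [intervalIntegral.integral_const_mul]
      · exact fun b _ => hint _ (hcont a b)
    · exact fun a _ => hint _ (continuousOn_finsetSum _ fun b _ => hcont a b)
  have hnn : 0 ≤ ∫ τ in (-r)..0, (y τ - z τ) ⬝ᵥ (S *ᵥ (y τ - z τ)) := by
    apply intervalIntegral.integral_nonneg hle
    intro τ _
    have := hS.posSemidef.dotProduct_mulVec_nonneg (y τ - z τ)
    simpa using this
  have e1 := hquad (fun τ => y τ - z τ) (fun i => (hyi i).sub (hzi i))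
  simp only [Pi.sub_apply, hyy] at e1
  rw [e1] at hnn
  have e2 : w ⬝ᵥ ((G⁻¹ ⊗ₖ S) *ᵥ w) = ∑ a, ∑ b, S a b * ∑ j, c j b * w (j, a) := by
    simp only [dotProduct, mulVec, Fintype.sum_prod_type, kroneckerMap_apply, hc,
      Finset.mul_sum, Finset.sum_mul]
    rw [Finset.sum_comm]
    refine Finset.sum_congr rfl fun a _ => ?_
    rw [Finset.sum_comm' (t' := Finset.univ) (s' := fun _ => Finset.univ) (by simp)]
    conv_rhs => 
      rw [Finset.sum_comm]
      enter [2, j]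
      rw [Finset.sum_comm]
    rw [Finset.sum_comm]
    refine Finset.sum_congr rfl fun _ _ => Finset.sum_congr rfl fun _ _ =>
      Finset.sum_congr rfl fun _ _ => by ring
  rw [hquad y hyi, e2]
  simp only [mul_sub, Finset.sum_sub_distrib] at hnn
  have e3 : ∑ a, ∑ b, S a b * ∑ j, c j b * w (j, a) =
      ∑ a, ∑ b, S a b * ∑ j, c j a * w (j, b) :=
    Finset.sum_congr rfl fun a _ => Finset.sum_congr rfl fun b _ => by rw [hPs b a]
  rw [e3]
  linarith
end

section
/- Let r > 0, n, ν, d ∈ ℕ, let f : [−r, 0] → ℝ^d be continuous with Gram matrix G = ∫_{−r}^{0} f(τ) f(τ)ᵀ dτ positive definite, set ϱ = νd and 𝖥 = G^{−1}, and let P ∈ ℝ^{(n+ϱ)×(n+ϱ)}, S ∈ ℝ^{ν×ν}, U ∈ ℝ^{ν×ν} be symmetric. Define, for ξ ∈ ℝ^n and continuous φ : [−r, 0] → ℝ^ν, the functional v(ξ, φ) = [ξ; w]ᵀ P [ξ; w] + ∫_{−r}^{0} φ(τ)ᵀ (S + (τ+r) U) φ(τ) dτ, where w = ∫_{−r}^{0}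 (f(τ) ⊗ I_ν) φ(τ) dτ. Assume S and U are positive definite and that the block-diagonal perturbation P + (0_{n×n} ⊕ (𝖥 ⊗ S)) is positive definite. Then there exists ε₁ > 0 such that for all ξ ∈ ℝ^n and all continuous φ : [−r, 0] → ℝ^ν, v(ξ, φ) ≥ ε₁ ‖ξ‖₂². -/
open Matrix MeasureTheory
open scoped Kronecker

/-- The Euclidean (`ℓ²`) norm of a finite real vector. -/
noncomputable def euclNorm {k : Type*} [Fintype k] (v : k → ℝ) : ℝ :=
  Real.sqrt (∑ i, v i ^ 2)

theorem posDef_lower_bound {k : Type*} [Fintype k] (M : Matrix k k ℝ) (hM : M.PosDef) :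
    ∃ ε > 0, ∀ x : k → ℝ, ε * (x ⬝ᵥ x) ≤ x ⬝ᵥ (M *ᵥ x) := by
  have hcont : Continuous fun x : k → ℝ => x ⬝ᵥ (M *ᵥ x) := by
    simp only [dotProduct, mulVec]; fun_prop
  have hcont2 : Continuous fun x : k → ℝ => x ⬝ᵥ x := by
    simp only [dotProduct]; fun_prop
  have hclosed : IsClosed {x : k → ℝ | x ⬝ᵥ x = 1} := isClosed_eq hcont2 continuous_const
  have hcomp : IsCompact {x : k → ℝ | x ⬝ᵥ x = 1} := by
    refine (isCompact_closedBall (0 : k → ℝ) 1).of_isClosed_subset hclosed ?_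
    intro x hx
    rw [mem_closedBall_zero_iff, pi_norm_le_iff_of_nonneg zero_le_one]
    intro i
    have h1 : x i * x i ≤ x ⬝ᵥ x :=
      Finset.single_le_sum (f := fun i => x i * x i) (fun j _ => mul_self_nonneg _)
        (Finset.mem_univ i)
    have h2 : x ⬝ᵥ x = 1 := hx
    rw [Real.norm_eq_abs]
    exact abs_le_one_iff_mul_self_le_one.mpr (by linarith)
  have key : ∀ ε : ℝ, (∀ x : k → ℝ, x ⬝ᵥ x = 1 → ε ≤ x ⬝ᵥ (M *ᵥ x)) →
      ∀ x : k → ℝ, ε * (x ⬝ᵥ x) ≤ x ⬝ᵥ (M *ᵥ x) := by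
    intro ε h x
    by_cases hx : x = 0
    · simp [hx]
    have hpos : 0 < x ⬝ᵥ x := by
      have h0 : 0 ≤ x ⬝ᵥ x := Finset.sum_nonneg fun j _ => mul_self_nonneg _
      exact lt_of_le_of_ne h0 (fun e => hx (dotProduct_self_eq_zero.mp e.symm))
    set s := Real.sqrt (x ⬝ᵥ x) with hs
    have hs2 : s * s = x ⬝ᵥ x := Real.mul_self_sqrt hpos.le
    have hs0 : 0 < s := Real.sqrt_pos.mpr hpos
    have := h (s⁻¹ • x) (by
      rw [smul_dotProduct, dotProduct_smul, ← hs2]; simp only [smul_eq_mul]; field_simp)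
    rw [mulVec_smul, smul_dotProduct, dotProduct_smul] at this
    simp only [smul_eq_mul] at this
    rw [← hs2]
    have h3 : x ⬝ᵥ (M *ᵥ x) = (s * s) * (s⁻¹ * (s⁻¹ * (x ⬝ᵥ (M *ᵥ x)))) := by field_simp
    rw [h3, mul_comm ε]
    exact mul_le_mul_of_nonneg_left this (by positivity)
  rcases Set.eq_empty_or_nonempty {x : k → ℝ | x ⬝ᵥ x = 1} with he | hne
  · refine ⟨1, one_pos, key 1 fun x hx => ?_⟩
    have : x ∈ {x : k → ℝ | x ⬝ᵥ x = 1} := hx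
    rw [he] at this
    exact this.elim
  · obtain ⟨x0, hx0, hmin⟩ := hcomp.exists_isMinOn hne hcont.continuousOn
    refine ⟨x0 ⬝ᵥ (M *ᵥ x0), ?_, key _ fun x hx => hmin hx⟩
    have hne0 : x0 ≠ 0 := by
      rintro rfl
      simp at hx0
    simpa using hM.dotProduct_mulVec_pos hne0

theorem quad_ineq {ν : ℕ} (S : Matrix (Fin ν) (Fin ν) ℝ) (hSs : S.IsSymm) (hS : S.PosDef)
    (x y : Fin ν → ℝ) :
    2 * (y ⬝ᵥ (S *ᵥ x)) - y ⬝ᵥ (S *ᵥ y) ≤ x ⬝ᵥ (S *ᵥ x) := by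
  have h := hS.posSemidef.dotProduct_mulVec_nonneg (x - y)
  have hsym : x ⬝ᵥ (S *ᵥ y) = y ⬝ᵥ (S *ᵥ x) := by
    rw [dotProduct_mulVec, ← mulVec_transpose, hSs.eq, dotProduct_comm]
  simp only [star_trivial, mulVec_sub, dotProduct_sub, sub_dotProduct] at h
  linarith

theorem int_component {r : ℝ} (hr : 0 < r) {k : Type*} [Fintype k] (g : ℝ → k → ℝ)
    (hg : ContinuousOn g (Set.Icc (-r) 0)) (p : k) :
    (∫ τ in (-r)..0, g τ) p = ∫ τ in (-r)..0, g τ p := by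
  have hi : IntervalIntegrable g volume (-r) 0 :=
    ContinuousOn.intervalIntegrable (by rwa [Set.uIcc_of_le (by linarith)])
  exact ((ContinuousLinearMap.proj (R := ℝ) (φ := fun _ : k => ℝ) p).intervalIntegral_comp_comm
    hi).symm

/-- Bessel-type inequality. -/
theorem bessel_ineq (r : ℝ) (hr : 0 < r) (ν d : ℕ)
    (f : ℝ → Fin d → ℝ) (hf : ContinuousOn f (Set.Icc (-r) 0))
    (G : Matrix (Fin d) (Fin d) ℝ)
    (hG : ∀ i j, G i j = ∫ τ in (-r)..0, f τ i * f τ j)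
    (hGpd : G.PosDef)
    (S : Matrix (Fin ν) (Fin ν) ℝ) (hSsymm : S.IsSymm) (hS : S.PosDef)
    (φ : ℝ → Fin ν → ℝ) (hφ : ContinuousOn φ (Set.Icc (-r) 0))
    (w : Fin d × Fin ν → ℝ) (hw : ∀ p, w p = ∫ τ in (-r)..0, f τ p.1 * φ τ p.2) :
    w ⬝ᵥ ((G⁻¹ ⊗ₖ S) *ᵥ w) ≤ ∫ τ in (-r)..0, φ τ ⬝ᵥ (S *ᵥ φ τ) := by
  have hu : Set.uIcc (-r) 0 = Set.Icc (-r) 0 := Set.uIcc_of_le (by linarith)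
  have hfi : ∀ i, ContinuousOn (fun τ => f τ i) (Set.uIcc (-r) 0) := fun i => by
    rw [hu]; exact continuousOn_pi.mp hf i
  have hφi : ∀ i, ContinuousOn (fun τ => φ τ i) (Set.uIcc (-r) 0) := fun i => by
    rw [hu]; exact continuousOn_pi.mp hφ i
  let C : Fin d → Fin ν → ℝ := fun i a => ∑ k, G⁻¹ i k * w (k, a)
  have hGC : ∀ i b, ∑ j, G i j * C j b = w (i, b) := by
    intro i b
    have h1 : G * G⁻¹ = 1 := Matrix.mul_nonsing_inv _ (Matrix.isUnit_iff_isUnit_det _ |>.mp hGpd.isUnit)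
    have h2 : G *ᵥ (G⁻¹ *ᵥ fun k => w (k, b)) = fun k => w (k, b) := by
      rw [mulVec_mulVec, h1, one_mulVec]
    exact congrFun h2 i
  let ψ : ℝ → Fin ν → ℝ := fun τ a => ∑ i, C i a * f τ i
  let T : ℝ := ∑ i, ∑ a, ∑ b, C i a * S a b * w (i, b)
  have hT : w ⬝ᵥ ((G⁻¹ ⊗ₖ S) *ᵥ w) = T := by
    simp only [T, C, dotProduct, mulVec, Fintype.sum_prod_type, kroneckerMap_apply,
      Finset.mul_sum, Finset.sum_mul]
    refine Finset.sum_congr rfl fun i _ => ?_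
    conv_rhs => rw [Finset.sum_comm]
    refine Finset.sum_congr rfl fun a _ => ?_
    rw [Finset.sum_comm]
    refine Finset.sum_congr rfl fun b _ => ?_
    refine Finset.sum_congr rfl fun k _ => ?_
    rw [← hSsymm.apply]
    ring
  have e1 : ∀ τ, ψ τ ⬝ᵥ (S *ᵥ φ τ) = ∑ i, ∑ a, ∑ b, C i a * S a b * (f τ i * φ τ b) := by
    intro τ
    conv_rhs => rw [Finset.sum_comm]
    simp only [ψ, dotProduct, mulVec]
    refine Finset.sum_congr rfl fun a _ => ?_
    rw [Finset.sum_mul_sum]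
    refine Finset.sum_congr rfl fun i _ => Finset.sum_congr rfl fun b _ => ?_
    ring
  have e2 : ∀ τ, ψ τ ⬝ᵥ (S *ᵥ ψ τ) =
      ∑ i, ∑ a, ∑ b, ∑ j, C i a * S a b * C j b * (f τ i * f τ j) := by
    intro τ
    conv_rhs => rw [Finset.sum_comm]
    simp only [ψ, dotProduct, mulVec]
    refine Finset.sum_congr rfl fun a _ => ?_
    rw [Finset.sum_mul_sum]
    refine Finset.sum_congr rfl fun i _ => Finset.sum_congr rfl fun b _ => ?_
    rw [Finset.mul_sum, Finset.mul_sum]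
    refine Finset.sum_congr rfl fun j _ => ?_
    ring
  have c1 : ContinuousOn (fun τ => ψ τ ⬝ᵥ (S *ᵥ φ τ)) (Set.uIcc (-r) 0) := by
    simp only [e1]; fun_prop
  have c2 : ContinuousOn (fun τ => ψ τ ⬝ᵥ (S *ᵥ ψ τ)) (Set.uIcc (-r) 0) := by
    simp only [e2]; fun_prop
  have c3 : ContinuousOn (fun τ => φ τ ⬝ᵥ (S *ᵥ φ τ)) (Set.uIcc (-r) 0) := by
    simp only [dotProduct, mulVec]; fun_prop
  have i1 : ∫ τ in (-r)..0, ψ τ ⬝ᵥ (S *ᵥ φ τ) = T := by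
    simp only [e1, T]
    rw [intervalIntegral.integral_finsetSum fun i _ => ContinuousOn.intervalIntegrable (by fun_prop)]
    refine Finset.sum_congr rfl fun i _ => ?_
    rw [intervalIntegral.integral_finsetSum fun i _ => ContinuousOn.intervalIntegrable (by fun_prop)]
    refine Finset.sum_congr rfl fun a _ => ?_
    rw [intervalIntegral.integral_finsetSum fun i _ => ContinuousOn.intervalIntegrable (by fun_prop)]
    refine Finset.sum_congr rfl fun b _ => ?_
    rw [intervalIntegral.integral_const_mul, hw]
  have i2 : ∫ τ in (-r)..0, ψ τ ⬝ᵥ (S *ᵥ ψ τ) = T := by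
    simp only [e2, T]
    rw [intervalIntegral.integral_finsetSum fun i _ => ContinuousOn.intervalIntegrable (by fun_prop)]
    refine Finset.sum_congr rfl fun i _ => ?_
    rw [intervalIntegral.integral_finsetSum fun i _ => ContinuousOn.intervalIntegrable (by fun_prop)]
    refine Finset.sum_congr rfl fun a _ => ?_
    rw [intervalIntegral.integral_finsetSum fun i _ => ContinuousOn.intervalIntegrable (by fun_prop)]
    refine Finset.sum_congr rfl fun b _ => ?_
    rw [intervalIntegral.integral_finsetSum fun i _ => ContinuousOn.intervalIntegrable (by fun_prop)]
    rw [← hGC, Finset.mul_sum]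
    refine Finset.sum_congr rfl fun j _ => ?_
    rw [intervalIntegral.integral_const_mul, ← hG]
    ring
  have hmono : ∫ τ in (-r)..0, (2 * (ψ τ ⬝ᵥ (S *ᵥ φ τ)) - ψ τ ⬝ᵥ (S *ᵥ ψ τ)) ≤
      ∫ τ in (-r)..0, φ τ ⬝ᵥ (S *ᵥ φ τ) :=
    intervalIntegral.integral_mono_on (by linarith)
      (ContinuousOn.intervalIntegrable (by fun_prop)) c3.intervalIntegrable
      fun τ _ => quad_ineq S hSsymm hS _ _
  rw [intervalIntegral.integral_sub (ContinuousOn.intervalIntegrable (by fun_prop))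
    c2.intervalIntegrable, intervalIntegral.integral_const_mul, i1, i2] at hmono
  linarith

/-- If the Gram matrix `G = ∫_{-r}^0 f fᵀ` is positive definite, `S, U ≻ 0` and
`P + (0_{n×n} ⊕ (G⁻¹ ⊗ S)) ≻ 0`, then the Krasovskii functional
`v(ξ, φ) = [ξ; w]ᵀ P [ξ; w] + ∫_{-r}^0 φ(τ)ᵀ (S + (τ+r) U) φ(τ) dτ`,
with `w = ∫_{-r}^0 (f(τ) ⊗ I_ν) φ(τ) dτ`, admits a lower bound
`v(ξ, φ) ≥ ε₁ ‖ξ‖₂²` uniformly in `ξ` and continuous `φ`. -/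
theorem krasovskii_functional_lower_bound (r : ℝ) (hr : 0 < r) (n ν d : ℕ)
    (f : ℝ → Fin d → ℝ) (hf : ContinuousOn f (Set.Icc (-r) 0))
    (G : Matrix (Fin d) (Fin d) ℝ)
    (hG : ∀ i j, G i j = ∫ τ in (-r)..0, f τ i * f τ j)
    (hGpd : G.PosDef)
    (P : Matrix (Fin n ⊕ Fin d × Fin ν) (Fin n ⊕ Fin d × Fin ν) ℝ) (hP : P.IsSymm)
    (S U : Matrix (Fin ν) (Fin ν) ℝ) (hSsymm : S.IsSymm) (hUsymm : U.IsSymm)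
    (hS : S.PosDef) (hU : U.PosDef)
    (hblk : (P + Matrix.fromBlocks (0 : Matrix (Fin n) (Fin n) ℝ) 0 0
        (G⁻¹ ⊗ₖ S)).PosDef) :
    ∃ ε₁ > 0, ∀ (ξ : Fin n → ℝ) (φ : ℝ → Fin ν → ℝ), ContinuousOn φ (Set.Icc (-r) 0) →
      (Sum.elim ξ (∫ τ in (-r)..0, (vecKronId d ν (f τ)) *ᵥ φ τ)) ⬝ᵥ
          (P *ᵥ Sum.elim ξ (∫ τ in (-r)..0, (vecKronId d ν (f τ)) *ᵥ φ τ)) +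
        (∫ τ in (-r)..0, φ τ ⬝ᵥ ((S + (τ + r) • U) *ᵥ φ τ)) ≥
      ε₁ * euclNorm ξ ^ 2 := by
  obtain ⟨ε, hε, hlow⟩ := posDef_lower_bound _ hblk
  refine ⟨ε, hε, fun ξ φ hφ => ?_⟩
  have hu : Set.uIcc (-r) 0 = Set.Icc (-r) 0 := Set.uIcc_of_le (by linarith)
  have hfi : ∀ i, ContinuousOn (fun τ => f τ i) (Set.Icc (-r) 0) := continuousOn_pi.mp hf
  have hφi : ∀ i, ContinuousOn (fun τ => φ τ i) (Set.Icc (-r) 0) := continuousOn_pi.mp hφ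
  have hv : ∀ τ p, ((vecKronId d ν (f τ)) *ᵥ φ τ) p = f τ p.1 * φ τ p.2 := by
    intro τ p
    simp [vecKronId, mulVec, dotProduct, Matrix.one_apply]
  have hw : ∀ p, (∫ τ in (-r)..0, (vecKronId d ν (f τ)) *ᵥ φ τ) p =
      ∫ τ in (-r)..0, f τ p.1 * φ τ p.2 := by
    intro p
    rw [int_component hr]
    · simp only [hv]
    · rw [continuousOn_pi]
      intro q
      simp only [hv]
      exact (hfi _).mul (hφi _)
  generalize (∫ τ in (-r)..0, (vecKronId d ν (f τ)) *ᵥ φ τ) = w at hw ⊢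
  have hb := bessel_ineq r hr ν d f hf G hG hGpd S hSsymm hS φ hφ w hw
  have hm : ∫ τ in (-r)..0, φ τ ⬝ᵥ (S *ᵥ φ τ) ≤
      ∫ τ in (-r)..0, φ τ ⬝ᵥ ((S + (τ + r) • U) *ᵥ φ τ) := by
    refine intervalIntegral.integral_mono_on (by linarith)
      (ContinuousOn.intervalIntegrable ?_) (ContinuousOn.intervalIntegrable ?_) ?_
    · rw [hu]
      simp only [dotProduct, mulVec]; fun_prop
    · rw [hu]
      simp only [dotProduct, mulVec, Matrix.add_apply, Matrix.smul_apply, smul_eq_mul]; fun_prop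
    · intro τ hτ
      have h := hU.posSemidef.dotProduct_mulVec_nonneg (φ τ)
      rw [star_trivial] at h
      rw [add_mulVec, dotProduct_add, smul_mulVec, dotProduct_smul, smul_eq_mul]
      have := mul_nonneg (show 0 ≤ τ + r by linarith [hτ.1]) h
      linarith
  have hl := hlow (Sum.elim ξ w)
  rw [add_mulVec, dotProduct_add, fromBlocks_mulVec] at hl
  simp only [Sum.elim_comp_inl, Sum.elim_comp_inr, sumElim_dotProduct_sumElim, zero_mulVec,
    zero_add, dotProduct_zero, add_zero] at hl
  have hn : euclNorm ξ ^ 2 = ξ ⬝ᵥ ξ := by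
    rw [euclNorm, Real.sq_sqrt (Finset.sum_nonneg fun i _ => sq_nonneg _)]
    simp [dotProduct, sq]
  have hw0 : 0 ≤ w ⬝ᵥ w := Finset.sum_nonneg fun j _ => mul_self_nonneg _
  have := mul_nonneg hε.le hw0
  rw [hn]
  rw [mul_add] at hl
  linarith
end
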